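/- Let p be an odd prime, let F = ZMod p, let M ∈ F × F and r ∈ F with r ≠ 0. Then there exist two disjoint sets C₁, C₂ whose union is the circle C(M,r)_F such that: for any two points P, Q both in C₁ or both in C₂, D²(P,Q) is a square in F; for P ∈ C₁ and Q ∈ C₂, D²(P,Q) is not a square in F; and |C₁| = |C₂|, where this common cardinality equals (p+1)/2 if −1 is not a square in ZMod p and equals (p−1)/2 if −1 is a square in ZMod p. -/

import Mathlib

/-- Squared distance between two points of `(ZMod p) × (ZMod p)`. -/
def sqDist {F : Type*} [CommRing F] (P Q : F × F) : F :=
  (P.1 - Q.1) ^ 2 + (P.2 - Q.2) ^ 2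

/-- The circle of radius `1` centred at the origin of `F × F`. -/
def unitCircle (F : Type*) [Field F] : Set (F × F) :=
  {P | P.1 ^ 2 + P.2 ^ 2 = 1}

/-- The points of the unit circle at square squared distance from `(-1, 0)`. -/
def squareHalf (F : Type*) [Field F] : Set (F × F) :=
  {P ∈ unitCircle F | IsSquare (2 + 2 * P.1)}

section UnitCircle

variable {F : Type*} [Field F]

theorem eq_of_sqDist_eq_zero (h2 : (2 : F) ≠ 0) {P Q : F × F} (hP : P ∈ unitCircle F)
    (hQ : Q ∈ unitCircle F) (h : sqDist P Q = 0) : P = Q := by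
  obtain ⟨a, b⟩ := P
  obtain ⟨c, d⟩ := Q
  simp only [unitCircle, Set.mem_ofPred_eq, sqDist] at hP hQ h
  have hdot : a * c + b * d = 1 := by
    apply mul_left_cancel₀ h2
    linear_combination hP + hQ - h
  have hdet : a * d - b * c = 0 := by
    apply pow_eq_zero_iff (two_ne_zero) |>.mp
    linear_combination (c ^ 2 + d ^ 2) * hP + hQ - (a * c + b * d + 1) * hdot
  ext
  · linear_combination c * hdot + d * hdet - a * hQ
  · linear_combination d * hdot - c * hdet - b * hQ

/-- Up to a square, the squared distance of two points of the unit circle is the product of their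
squared distances from `(-1, 0)`. -/
theorem mul_sqDist_of_mem_unitCircle {P Q : F × F} (hP : P ∈ unitCircle F)
    (hQ : Q ∈ unitCircle F) :
    (2 + 2 * P.1) * (2 + 2 * Q.1) * sqDist P Q =
      (2 * (P.2 * (1 + Q.1) - Q.2 * (1 + P.1))) ^ 2 := by
  simp only [unitCircle, Set.mem_ofPred_eq, sqDist] at hP hQ ⊢
  linear_combination (4 * (1 + P.1) * (1 + Q.1) - 4 * (1 + Q.1) ^ 2) * hP +
    (4 * (1 + P.1) * (1 + Q.1) - 4 * (1 + P.1) ^ 2) * hQ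

theorem sqDist_eq_of_two_add_eq_zero (h2 : (2 : F) ≠ 0) {P Q : F × F} (hP : P ∈ unitCircle F)
    (hQ : Q ∈ unitCircle F) (h : 2 + 2 * P.1 = 0) : sqDist P Q = 2 + 2 * Q.1 := by
  simp only [unitCircle, Set.mem_ofPred_eq, sqDist] at hP hQ ⊢
  have h1 : P.1 = -1 := mul_left_cancel₀ h2 (by linear_combination h)
  have h0 : P.2 = 0 := by
    apply pow_eq_zero_iff two_ne_zero |>.mp
    linear_combination hP - (P.1 - 1) * h1
  rw [h1, h0]
  linear_combination hQ

theorem sqDist_comm (P Q : F × F) : sqDist P Q = sqDist Q P := by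
  simp only [sqDist]
  ring

theorem isSquare_of_mul_isSquare {a b : F} (ha : a ≠ 0) (hsq : IsSquare a)
    (h : IsSquare (a * b)) : IsSquare b := by
  simpa [ha] using h.div hsq

theorem isSquare_sqDist_of_mem_squareHalf (h2 : (2 : F) ≠ 0) {P Q : F × F}
    (hP : P ∈ squareHalf F) (hQ : Q ∈ squareHalf F) : IsSquare (sqDist P Q) := by
  by_cases hp : 2 + 2 * P.1 = 0
  · rw [sqDist_eq_of_two_add_eq_zero h2 hP.1 hQ.1 hp]
    exact hQ.2
  by_cases hq : 2 + 2 * Q.1 = 0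
  · rw [sqDist_comm, sqDist_eq_of_two_add_eq_zero h2 hQ.1 hP.1 hq]
    exact hP.2
  refine isSquare_of_mul_isSquare (mul_ne_zero hp hq) (hP.2.mul hQ.2) ?_
  rw [mul_sqDist_of_mem_unitCircle hP.1 hQ.1]
  exact IsSquare.sq _

theorem not_isSquare_sqDist_of_mem_squareHalf (h2 : (2 : F) ≠ 0) {P Q : F × F}
    (hP : P ∈ squareHalf F) (hQ : Q ∈ unitCircle F \ squareHalf F) :
    ¬ IsSquare (sqDist P Q) := by
  intro h
  refine hQ.2 ⟨hQ.1, ?_⟩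
  by_cases hp : 2 + 2 * P.1 = 0
  · rwa [← sqDist_eq_of_two_add_eq_zero h2 hP.1 hQ.1 hp]
  have hd : sqDist P Q ≠ 0 := fun h0 =>
    hQ.2 (eq_of_sqDist_eq_zero h2 hP.1 hQ.1 h0 ▸ hP)
  refine isSquare_of_mul_isSquare (mul_ne_zero hp hd) (hP.2.mul h) ?_
  rw [mul_right_comm, mul_sqDist_of_mem_unitCircle hP.1 hQ.1]
  exact IsSquare.sq _

/-- Complex squaring, in coordinates. -/
def doubleAngle (P : F × F) : F × F :=
  (P.1 ^ 2 - P.2 ^ 2, 2 * P.1 * P.2)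

theorem doubleAngle_mem_squareHalf {P : F × F} (hP : P ∈ unitCircle F) :
    doubleAngle P ∈ squareHalf F := by
  simp only [squareHalf, unitCircle, Set.mem_ofPred_eq, doubleAngle] at hP ⊢
  refine ⟨?_, 2 * P.1, ?_⟩
  · linear_combination (P.1 ^ 2 + P.2 ^ 2 + 1) * hP
  · linear_combination -2 * hP

theorem exists_doubleAngle_eq (h2 : (2 : F) ≠ 0) {Q : F × F} (hQ : Q ∈ squareHalf F) :
    ∃ P ∈ unitCircle F, doubleAngle P = Q := by
  obtain ⟨a, b⟩ := Q
  obtain ⟨hc, s, hs⟩ := hQ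
  simp only [unitCircle, Set.mem_ofPred_eq] at hc hs ⊢
  by_cases h0 : s = 0
  · subst h0
    have ha : a = -1 := mul_left_cancel₀ h2 (by linear_combination hs)
    have hb : b = 0 := by
      apply pow_eq_zero_iff two_ne_zero |>.mp
      linear_combination hc - (a - 1) * ha
    exact ⟨(0, 1), by simp, by simp [doubleAngle, ha, hb]⟩
  · obtain rfl : a = s ^ 2 / 2 - 1 := by
      field_simp
      linear_combination hs
    have h4 : (4 : F) ≠ 0 := by
      rw [show (4 : F) = 2 * 2 by norm_num]
      exact mul_ne_zero h2 h2
    have hb : b ^ 2 = s ^ 2 - s ^ 4 / 4 := by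
      field_simp at hc ⊢
      linear_combination hc
    refine ⟨(s / 2, b / s), ?_, ?_⟩
    · simp only [div_pow, hb]
      field_simp
      ring
    · simp only [doubleAngle, div_pow, hb]
      ext
      · field_simp
        ring
      · field_simp

theorem doubleAngle_eq_iff (h2 : (2 : F) ≠ 0) {P Q : F × F} (hP : P ∈ unitCircle F)
    (hQ : Q ∈ unitCircle F) : doubleAngle P = doubleAngle Q ↔ P = Q ∨ P = -Q := by
  obtain ⟨a, b⟩ := P
  obtain ⟨c, d⟩ := Q
  simp only [unitCircle, Set.mem_ofPred_eq, doubleAngle, Prod.mk.injEq, Prod.neg_mk] at hP hQ ⊢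
  constructor
  · rintro ⟨h1, h3⟩
    have hac : a ^ 2 = c ^ 2 := mul_left_cancel₀ h2 (by linear_combination h1 + hP - hQ)
    have hab : a * b = c * d := mul_left_cancel₀ h2 (by linear_combination h3)
    have hbd : b ^ 2 = d ^ 2 := by linear_combination hP - hQ - hac
    by_cases hc : c = 0
    · have ha : a = 0 := by simpa [hc] using hac
      rcases sq_eq_sq_iff_eq_or_eq_neg.mp hbd with h | h
      · exact Or.inl ⟨by rw [ha, hc], h⟩
      · exact Or.inr ⟨by simp [ha, hc], h⟩
    · rcases sq_eq_sq_iff_eq_or_eq_neg.mp hac with rfl | rfl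
      · exact Or.inl ⟨rfl, mul_left_cancel₀ hc hab⟩
      · exact Or.inr ⟨rfl, mul_left_cancel₀ hc (by linear_combination -hab)⟩
  · rintro (⟨rfl, rfl⟩ | ⟨rfl, rfl⟩)
    · exact ⟨rfl, rfl⟩
    · exact ⟨by ring, by ring⟩

theorem ncard_unitCircle_eq_two_mul [Finite F] (h2 : (2 : F) ≠ 0) :
    (unitCircle F).ncard = 2 * (squareHalf F).ncard := by
  classical
  have := Fintype.ofFinite F
  have hmaps : ∀ P ∈ (unitCircle F).toFinset, doubleAngle P ∈ (squareHalf F).toFinset := by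
    simpa only [Set.mem_toFinset] using fun P hP => doubleAngle_mem_squareHalf hP
  rw [Set.ncard_eq_toFinset_card', Set.ncard_eq_toFinset_card', mul_comm,
    Finset.card_eq_sum_card_fiberwise hmaps]
  refine Finset.sum_const_nat fun Q hQ => ?_
  obtain ⟨P, hP, rfl⟩ := exists_doubleAngle_eq h2 (Set.mem_toFinset.mp hQ)
  have hneg : -P ∈ unitCircle F := by simpa [unitCircle] using hP
  have hfib : {R ∈ (unitCircle F).toFinset | doubleAngle R = doubleAngle P} = {P, -P} := by
    ext R
    simp only [Finset.mem_filter, Set.mem_toFinset, Finset.mem_insert, Finset.mem_singleton]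
    refine ⟨fun h => (doubleAngle_eq_iff h2 h.1 hP).mp h.2, ?_⟩
    intro h
    have hR : R ∈ unitCircle F := by rcases h with rfl | rfl <;> assumption
    exact ⟨hR, (doubleAngle_eq_iff h2 hR hP).mpr h⟩
  rw [hfib, Finset.card_pair]
  intro h
  obtain ⟨ha, hb⟩ := Prod.ext_iff.mp h
  have ha0 : P.1 = 0 := mul_left_cancel₀ h2 (by rw [Prod.fst_neg] at ha; linear_combination ha)
  have hb0 : P.2 = 0 := mul_left_cancel₀ h2 (by rw [Prod.snd_neg] at hb; linear_combination hb)
  simp [unitCircle, ha0, hb0] at hP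

theorem ncard_unitCircle_add [Finite F] (h2 : (2 : F) ≠ 0) :
    (unitCircle F).ncard + {t : F | t ^ 2 = -1}.ncard = Nat.card F + 1 := by
  have himg : unitCircle F = insert (-1, 0)
      ((fun t : F => ((1 - t ^ 2) / (1 + t ^ 2), 2 * t / (1 + t ^ 2))) '' {t | t ^ 2 = -1}ᶜ) := by
    ext ⟨a, b⟩
    simp only [unitCircle, Set.mem_ofPred_eq, Set.mem_insert_iff, Set.mem_image,
      Set.mem_compl_iff, Prod.mk.injEq]
    constructor
    · intro h
      by_cases ha : 1 + a = 0
      · have ha' : a = -1 := by linear_combination ha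
        refine Or.inl ⟨ha', ?_⟩
        apply pow_eq_zero_iff two_ne_zero |>.mp
        linear_combination h - (a - 1) * ha
      · have ht : 1 + (b / (1 + a)) ^ 2 = 2 / (1 + a) := by
          field_simp
          linear_combination h
        refine Or.inr ⟨b / (1 + a), fun h0 => ?_, ?_, ?_⟩
        · rw [h0] at ht
          exact div_ne_zero h2 ha (by linear_combination -ht)
        · rw [ht, show 1 - (b / (1 + a)) ^ 2 = 2 - 2 / (1 + a) by rw [← ht]; ring]
          field_simp
          ring
        · rw [ht]
          field_simp
    · rintro (⟨rfl, rfl⟩ | ⟨t, ht, rfl, rfl⟩)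
      · ring
      · have ht' : 1 + t ^ 2 ≠ 0 := fun h => ht (by linear_combination h)
        field_simp
        ring
  have hinj : Set.InjOn (fun t : F => ((1 - t ^ 2) / (1 + t ^ 2), 2 * t / (1 + t ^ 2)))
      {t | t ^ 2 = -1}ᶜ := by
    intro t ht u hu h
    have ht' : 1 + t ^ 2 ≠ 0 := fun h => ht (by simp only [Set.mem_ofPred_eq]; linear_combination h)
    have hu' : 1 + u ^ 2 ≠ 0 := fun h => hu (by simp only [Set.mem_ofPred_eq]; linear_combination h)
    simp only [Prod.mk.injEq] at h
    obtain ⟨h1, h3⟩ := h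
    rw [div_eq_div_iff ht' hu'] at h1 h3
    have hsq : t ^ 2 = u ^ 2 := mul_left_cancel₀ h2 (by linear_combination -h1)
    rw [hsq] at h3
    exact mul_left_cancel₀ h2 (mul_right_cancel₀ hu' h3)
  have hnot : ((-1 : F), (0 : F)) ∉
      (fun t : F => ((1 - t ^ 2) / (1 + t ^ 2), 2 * t / (1 + t ^ 2))) '' {t | t ^ 2 = -1}ᶜ := by
    rintro ⟨t, ht, h⟩
    have ht' : 1 + t ^ 2 ≠ 0 := fun h => ht (by simp only [Set.mem_ofPred_eq]; linear_combination h)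
    simp only [Prod.mk.injEq] at h
    have h1 := h.1
    rw [div_eq_iff ht'] at h1
    exact h2 (by linear_combination h1)
  rw [himg, Set.ncard_insert_of_notMem hnot, hinj.ncard_image]
  have := Set.ncard_add_ncard_compl {t : F | t ^ 2 = -1}
  omega

theorem ncard_sq_eq_neg_one (h2 : (2 : F) ≠ 0) [Decidable (∃ a : F, a ^ 2 = -1)] :
    {t : F | t ^ 2 = -1}.ncard = if ∃ a : F, a ^ 2 = -1 then 2 else 0 := by
  split_ifs with h
  · obtain ⟨i, hi⟩ := h
    have hset : {t : F | t ^ 2 = -1} = {i, -i} := by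
      ext t
      simp [← hi, sq_eq_sq_iff_eq_or_eq_neg]
    rw [hset, Set.ncard_pair]
    intro h
    have : i = 0 := mul_left_cancel₀ h2 (by linear_combination h)
    simp [this] at hi
  · push Not at h
    simp [h]

theorem isSquare_mul_of_not_isSquare [Finite F] {a b : F} (ha : ¬ IsSquare a)
    (hb : ¬ IsSquare b) : IsSquare (a * b) := by
  classical
  have := Fintype.ofFinite F
  have ha0 : a ≠ 0 := fun h => ha (h ▸ IsSquare.zero)
  have hb0 : b ≠ 0 := fun h => hb (h ▸ IsSquare.zero)
  rw [← quadraticChar_one_iff_isSquare (mul_ne_zero ha0 hb0), map_mul,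
    quadraticChar_neg_one_iff_not_isSquare.mpr ha, quadraticChar_neg_one_iff_not_isSquare.mpr hb]
  norm_num

theorem isSquare_sqDist_of_notMem_squareHalf [Finite F] {P Q : F × F}
    (hP : P ∈ unitCircle F \ squareHalf F) (hQ : Q ∈ unitCircle F \ squareHalf F) :
    IsSquare (sqDist P Q) := by
  have hp : ¬ IsSquare (2 + 2 * P.1) := fun h => hP.2 ⟨hP.1, h⟩
  have hq : ¬ IsSquare (2 + 2 * Q.1) := fun h => hQ.2 ⟨hQ.1, h⟩
  have hp0 : 2 + 2 * P.1 ≠ 0 := fun h => hp (h ▸ IsSquare.zero)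
  have hq0 : 2 + 2 * Q.1 ≠ 0 := fun h => hq (h ▸ IsSquare.zero)
  refine isSquare_of_mul_isSquare (mul_ne_zero hp0 hq0) (isSquare_mul_of_not_isSquare hp hq) ?_
  rw [mul_sqDist_of_mem_unitCircle hP.1 hQ.1]
  exact IsSquare.sq _

/-- The similarity taking the unit circle to the circle of centre `M` and radius `r`. -/
def similarity (M : F × F) (r : F) (P : F × F) : F × F :=
  (M.1 + r * P.1, M.2 + r * P.2)

theorem similarity_injective (M : F × F) {r : F} (hr : r ≠ 0) :
    Function.Injective (similarity M r) := by
  intro P Q h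
  simpa [similarity, hr, Prod.ext_iff] using h

theorem sqDist_similarity (M : F × F) (r : F) (P Q : F × F) :
    sqDist (similarity M r P) (similarity M r Q) = r ^ 2 * sqDist P Q := by
  simp only [sqDist, similarity]
  ring

theorem isSquare_sqDist_similarity (M : F × F) {r : F} (hr : r ≠ 0) (P Q : F × F) :
    IsSquare (sqDist (similarity M r P) (similarity M r Q)) ↔ IsSquare (sqDist P Q) := by
  rw [sqDist_similarity]
  exact ⟨isSquare_of_mul_isSquare (pow_ne_zero 2 hr) (IsSquare.sq r), (IsSquare.sq r).mul⟩

theorem image_similarity_unitCircle (M : F × F) {r : F} (hr : r ≠ 0) :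
    similarity M r '' unitCircle F = {P | (P.1 - M.1) ^ 2 + (P.2 - M.2) ^ 2 = r ^ 2} := by
  ext P
  simp only [unitCircle, Set.mem_image, Set.mem_ofPred_eq]
  constructor
  · rintro ⟨Q, hQ, rfl⟩
    simp only [similarity]
    linear_combination r ^ 2 * hQ
  · intro h
    refine ⟨((P.1 - M.1) / r, (P.2 - M.2) / r), ?_, ?_⟩
    · field_simp
      exact h
    · simp only [similarity]
      ext <;> field_simp <;> ring

end UnitCircle

open Classical in
/-- Over the prime field `ZMod p` with `p` an odd prime, a circle splits into two
disjoint halves: within a half all squared distances are squares, between the halves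
no squared distance is a square, and both halves have the same cardinality,
namely `(p+1)/2` if `-1` is not a square and `(p-1)/2` if `-1` is a square. -/
theorem circle_splits_into_two_rational_halves (p : ℕ) (hp : p.Prime) (hodd : p ≠ 2)
    (m₁ m₂ r : ZMod p) (hr : r ≠ 0) :
    ∃ C₁ C₂ : Set (ZMod p × ZMod p),
      Disjoint C₁ C₂ ∧
      C₁ ∪ C₂ = {P : ZMod p × ZMod p | (P.1 - m₁) ^ 2 + (P.2 - m₂) ^ 2 = r ^ 2} ∧
      (∀ P ∈ C₁, ∀ Q ∈ C₁, ∃ a : ZMod p, sqDist P Q = a ^ 2) ∧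
      (∀ P ∈ C₂, ∀ Q ∈ C₂, ∃ a : ZMod p, sqDist P Q = a ^ 2) ∧
      (∀ P ∈ C₁, ∀ Q ∈ C₂, ¬∃ a : ZMod p, sqDist P Q = a ^ 2) ∧
      C₁.ncard = C₂.ncard ∧
      C₁.ncard = (if ∃ a : ZMod p, a ^ 2 = -1 then (p - 1) / 2 else (p + 1) / 2) := by
  have : Fact p.Prime := ⟨hp⟩
  have h2 : (2 : ZMod p) ≠ 0 := Ring.two_ne_zero (by rwa [ZMod.ringChar_zmod_n])
  simp only [← isSquare_iff_exists_sq]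
  have hsub : squareHalf (ZMod p) ⊆ unitCircle (ZMod p) := fun _ h => h.1
  have hinj := similarity_injective (m₁, m₂) hr
  have htwo := ncard_unitCircle_eq_two_mul h2
  have hdiff := Set.ncard_sdiff_add_ncard_of_subset hsub
  refine ⟨similarity (m₁, m₂) r '' squareHalf (ZMod p),
    similarity (m₁, m₂) r '' (unitCircle (ZMod p) \ squareHalf (ZMod p)),
    (Set.disjoint_image_iff hinj).mpr Set.disjoint_sdiff_right, ?_, ?_, ?_, ?_, ?_, ?_⟩
  · rw [← Set.image_union, Set.union_sdiff_cancel hsub]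
    exact image_similarity_unitCircle (m₁, m₂) hr
  · rintro _ ⟨P, hP, rfl⟩ _ ⟨Q, hQ, rfl⟩
    exact (isSquare_sqDist_similarity _ hr P Q).mpr (isSquare_sqDist_of_mem_squareHalf h2 hP hQ)
  · rintro _ ⟨P, hP, rfl⟩ _ ⟨Q, hQ, rfl⟩
    exact (isSquare_sqDist_similarity _ hr P Q).mpr (isSquare_sqDist_of_notMem_squareHalf hP hQ)
  · rintro _ ⟨P, hP, rfl⟩ _ ⟨Q, hQ, rfl⟩
    exact (isSquare_sqDist_similarity _ hr P Q).not.mpr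
      (not_isSquare_sqDist_of_mem_squareHalf h2 hP hQ)
  · rw [Set.ncard_image_of_injective _ hinj, Set.ncard_image_of_injective _ hinj]
    omega
  · rw [Set.ncard_image_of_injective _ hinj]
    have hcard := ncard_unitCircle_add h2
    rw [ncard_sq_eq_neg_one h2, Nat.card_zmod] at hcard
    split_ifs at hcard ⊢ <;> omega
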